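/- Let f ∈ 𝒦 have radius of convergence R > 0, Khinchin family (X_t) and fulcrum F, and let Z denote a standard normal random variable. Fix an integer n ≥ 3. Then lim_{t↑R} E(X̆_t^j) = E(Z^j) for every 3 ≤ j ≤ n if and only if lim_{s↑ln R} F^{(j)}(s)/F″(s)^{j/2} = 0 for every 3 ≤ j ≤ n. -/

import Mathlib

open scoped BigOperators Topology
open Filter

namespace KhinchinPaper

/-- Sum of the power series with coefficients `a` at `t`. -/
noncomputable def fsum (a : ℕ → ℝ) (t : ℝ) : ℝ := ∑' n : ℕ, a n * t ^ n

/-- The class `𝒦`: non-constant power series with non-negative coefficients, `a 0 > 0`,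
and radius of convergence `R > 0`. -/
structure IsK (a : ℕ → ℝ) (R : ℝ) : Prop where
  pos₀ : 0 < a 0
  nonneg : ∀ n, 0 ≤ a n
  nonconst : ∃ n, 0 < n ∧ 0 < a n
  Rpos : 0 < R
  conv : ∀ t : ℝ, 0 ≤ t → t < R → Summable fun n : ℕ => a n * t ^ n
  radius : ∀ t : ℝ, R < t → ¬ Summable fun n : ℕ => a n * t ^ n

/-- Mean function `m_f(t) = t f'(t)/f(t)`. -/
noncomputable def mf (a : ℕ → ℝ) (t : ℝ) : ℝ :=
  (∑' n : ℕ, (n : ℝ) * a n * t ^ n) / fsum a t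

/-- Variance function `σ_f²(t)`. -/
noncomputable def sigma2 (a : ℕ → ℝ) (t : ℝ) : ℝ :=
  (∑' n : ℕ, (n : ℝ) ^ 2 * a n * t ^ n) / fsum a t - (mf a t) ^ 2

noncomputable def sigma (a : ℕ → ℝ) (t : ℝ) : ℝ := Real.sqrt (sigma2 a t)

/-- `k`-th moment of the normalized Khinchin family variable `X̆_t`. -/
noncomputable def normMoment (a : ℕ → ℝ) (t : ℝ) (k : ℕ) : ℝ :=
  ∑' n : ℕ, (a n * t ^ n / fsum a t) * (((n : ℝ) - mf a t) / sigma a t) ^ k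

/-- `k`-th central moment of `X_t`. -/
noncomputable def centralMoment (a : ℕ → ℝ) (t : ℝ) (k : ℕ) : ℝ :=
  ∑' n : ℕ, (a n * t ^ n / fsum a t) * ((n : ℝ) - mf a t) ^ k

/-- Characteristic function `E(e^{iθ X̆_t})` of the normalized variable. -/
noncomputable def charfun (a : ℕ → ℝ) (t θ : ℝ) : ℂ :=
  ∑' n : ℕ, ((a n * t ^ n / fsum a t : ℝ) : ℂ) *
    Complex.exp (Complex.I * (θ : ℂ) * ((((n : ℝ) - mf a t) / sigma a t : ℝ) : ℂ))

/-- `f` is Gaussian: `X̆_t → N(0,1)` in distribution as `t ↑ R`, expressed via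
pointwise convergence of characteristic functions (Lévy's continuity theorem). -/
def IsGaussian (a : ℕ → ℝ) (R : ℝ) : Prop :=
  ∀ θ : ℝ, Tendsto (fun t => charfun a t θ) (𝓝[<] R)
    (𝓝 (Complex.exp (-(θ : ℂ) ^ 2 / 2)))

/-- Gaussian for entire `f` (radius `R = ∞`, so `t → +∞`). -/
def IsGaussianEntire (a : ℕ → ℝ) : Prop :=
  ∀ θ : ℝ, Tendsto (fun t => charfun a t θ) atTop
    (𝓝 (Complex.exp (-(θ : ℂ) ^ 2 / 2)))

/-- The fulcrum `F(s) = log f(e^s)` restricted to the real axis. -/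
noncomputable def fulcrum (a : ℕ → ℝ) (s : ℝ) : ℝ := Real.log (fsum a (Real.exp s))

/-- The quotient `F^{(j)}(s) / F''(s)^{j/2}`. -/
noncomputable def Fq (a : ℕ → ℝ) (j : ℕ) (s : ℝ) : ℝ :=
  iteratedDeriv j (fulcrum a) s / (iteratedDeriv 2 (fulcrum a) s) ^ ((j : ℝ) / 2)

/-- Tuples `(m₂, …, m_n)` of non-negative integers with `2m₂ + ⋯ + n m_n = n`,
padded with `m₀ = m₁ = 0` and encoded as functions on `Fin (n+1)`. -/
def tuples (n : ℕ) : Finset (Fin (n + 1) → ℕ) :=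
  (Fintype.piFinset fun _ : Fin (n + 1) => Finset.range (n + 1)).filter
    fun m => m 0 = 0 ∧ m 1 = 0 ∧ ∑ j : Fin (n + 1), (j : ℕ) * m j = n

/-- Integer moments of a standard normal random variable `Z`. -/
noncomputable def gaussMoment (k : ℕ) : ℝ :=
  if Even k then (Nat.factorial k : ℝ) / ((Nat.factorial (k / 2) : ℝ) * 2 ^ (k / 2)) else 0

/-- The complex power series sum. -/
noncomputable def fsumC (a : ℕ → ℝ) (z : ℂ) : ℂ := ∑' n : ℕ, (a n : ℂ) * z ^ n

/-- The complex fulcrum `F(z) = log f(e^z)`. -/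
noncomputable def fulcrumC (a : ℕ → ℝ) (z : ℂ) : ℂ := Complex.log (fsumC a (Complex.exp z))

end KhinchinPaper

namespace KhinchinPaper

open MeasureTheory ProbabilityTheory

/-- The Leibniz rule applied to `deriv G = deriv (log ∘ G) * G`. -/
lemma iteratedDeriv_succ_eq_sum_log {G : ℝ → ℝ} {s : ℝ} (hG : AnalyticAt ℝ G s) (hpos : 0 < G s)
    (k : ℕ) :
    iteratedDeriv (k + 1) G s = ∑ i ∈ Finset.range (k + 1),
      (k.choose i : ℝ) * iteratedDeriv (i + 1) (fun x => Real.log (G x)) s *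
        iteratedDeriv (k - i) G s := by
  have hL : AnalyticAt ℝ (fun x => Real.log (G x)) s := hG.log hpos
  have hev : deriv G =ᶠ[𝓝 s] (deriv fun x => Real.log (G x)) * G := by
    filter_upwards [hG.eventually_analyticAt, hG.continuousAt.eventually (lt_mem_nhds hpos)]
      with x hx hx0
    rw [Pi.mul_apply, deriv.log hx.differentiableAt hx0.ne', div_mul_cancel₀ _ hx0.ne']
  rw [iteratedDeriv_succ', hev.iteratedDeriv_eq k,
    iteratedDeriv_mul hL.deriv.contDiffAt hG.contDiffAt]
  simp only [iteratedDeriv_succ']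

/-- The measure on `ℕ` with masses `a n`. -/
noncomputable def coeffMeasure (a : ℕ → ℝ) : Measure ℕ :=
  Measure.sum fun n => ENNReal.ofReal (a n) • Measure.dirac n

/-- The moment generating function of `n ↦ n - c` under the coefficient measure,
i.e. `s ↦ exp (-c s) f(exp s)`. -/
noncomputable def shiftedMgf (a : ℕ → ℝ) (c : ℝ) : ℝ → ℝ :=
  mgf (fun n : ℕ => (n : ℝ) - c) (coeffMeasure a)

section

variable {a : ℕ → ℝ} {R : ℝ}

lemma exp_mul_sub_eq (s c : ℝ) (n : ℕ) :
    Real.exp (s * ((n : ℝ) - c)) = Real.exp (-(c * s)) * Real.exp s ^ n := by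
  rw [← Real.exp_nat_mul, ← Real.exp_add]
  ring_nf

lemma integral_coeffMeasure (ha : ∀ n, 0 ≤ a n) (g : ℕ → ℝ) :
    ∫ n, g n ∂coeffMeasure a = ∑' n, a n * g n := by
  rw [coeffMeasure, integral_sum_dirac fun i => ENNReal.ofReal_ne_top]
  simp [ENNReal.toReal_ofReal, ha]

lemma integrable_coeffMeasure (ha : ∀ n, 0 ≤ a n) {g : ℕ → ℝ} :
    Integrable g (coeffMeasure a) ↔ Summable fun n => a n * |g n| := by
  rw [coeffMeasure, integrable_sum_dirac_iff fun i => ENNReal.ofReal_ne_top]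
  simp [ENNReal.toReal_ofReal, ha]

lemma mem_interior_integrableExpSet (hK : IsK a R) (c : ℝ) {s : ℝ} (hs : s < Real.log R) :
    s ∈ interior (integrableExpSet (fun n : ℕ => (n : ℝ) - c) (coeffMeasure a)) := by
  refine mem_interior.2 ⟨Set.Iio (Real.log R), fun u hu => ?_, isOpen_Iio, hs⟩
  have hu' : Real.exp u < R := (Real.lt_log_iff_exp_lt hK.Rpos).1 hu
  refine (integrable_coeffMeasure hK.nonneg).2 ?_
  refine ((hK.conv _ (Real.exp_pos u).le hu').mul_left (Real.exp (-(c * u)))).congr fun n => ?_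
  rw [abs_of_pos (Real.exp_pos _), exp_mul_sub_eq]
  ring

lemma analyticAt_shiftedMgf (hK : IsK a R) (c : ℝ) {s : ℝ} (hs : s < Real.log R) :
    AnalyticAt ℝ (shiftedMgf a c) s :=
  analyticAt_mgf (mem_interior_integrableExpSet hK c hs)

lemma shiftedMgf_eq (hK : IsK a R) (c s : ℝ) :
    shiftedMgf a c s = Real.exp (-(c * s)) * fsum a (Real.exp s) := by
  rw [shiftedMgf, mgf, integral_coeffMeasure hK.nonneg, fsum, ← tsum_mul_left]
  refine tsum_congr fun n => ?_
  rw [exp_mul_sub_eq]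
  ring

lemma iteratedDeriv_shiftedMgf (hK : IsK a R) (c : ℝ) {s : ℝ} (hs : s < Real.log R) (k : ℕ) :
    iteratedDeriv k (shiftedMgf a c) s =
      Real.exp (-(c * s)) * ∑' n : ℕ, a n * Real.exp s ^ n * ((n : ℝ) - c) ^ k := by
  rw [shiftedMgf, iteratedDeriv_mgf (mem_interior_integrableExpSet hK c hs),
    integral_coeffMeasure hK.nonneg, ← tsum_mul_left]
  refine tsum_congr fun n => ?_
  rw [exp_mul_sub_eq]
  ring

lemma summable_mul_sub_pow (hK : IsK a R) (c : ℝ) {s : ℝ} (hs : s < Real.log R) (k : ℕ) :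
    Summable fun n : ℕ => a n * Real.exp s ^ n * ((n : ℝ) - c) ^ k := by
  have h := (integrable_coeffMeasure hK.nonneg).1
    (integrable_pow_mul_exp_of_mem_interior_integrableExpSet
      (mem_interior_integrableExpSet hK c hs) k)
  refine Summable.of_norm ((h.mul_left (Real.exp (c * s))).congr fun n => ?_)
  rw [exp_mul_sub_eq, Real.norm_eq_abs, abs_mul, abs_mul (a n * _), abs_of_nonneg
    (mul_nonneg (hK.nonneg n) (pow_nonneg (Real.exp_pos s).le n)), abs_of_pos
    (show 0 < Real.exp (-(c * s)) * Real.exp s ^ n by positivity), Real.exp_neg]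
  field_simp

lemma fsum_pos (hK : IsK a R) {s : ℝ} (hs : s < Real.log R) : 0 < fsum a (Real.exp s) := by
  have hsum : Summable fun n : ℕ => a n * Real.exp s ^ n :=
    hK.conv _ (Real.exp_pos s).le ((Real.lt_log_iff_exp_lt hK.Rpos).1 hs)
  exact hsum.tsum_pos (fun n => mul_nonneg (hK.nonneg n) (pow_nonneg (Real.exp_pos s).le n)) 0
    (by simpa using hK.pos₀)

lemma shiftedMgf_pos (hK : IsK a R) (c : ℝ) {s : ℝ} (hs : s < Real.log R) :
    0 < shiftedMgf a c s := by
  rw [shiftedMgf_eq hK]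
  exact mul_pos (Real.exp_pos _) (fsum_pos hK hs)

lemma log_shiftedMgf_eventuallyEq (hK : IsK a R) (c : ℝ) {s : ℝ} (hs : s < Real.log R) :
    (fun x => Real.log (shiftedMgf a c x)) =ᶠ[𝓝 s] fun x => fulcrum a x - c * x := by
  filter_upwards [Iio_mem_nhds hs] with x hx
  rw [shiftedMgf_eq hK, Real.log_mul (Real.exp_pos _).ne' (fsum_pos hK hx).ne', Real.log_exp,
    fulcrum]
  ring

lemma analyticAt_fulcrum (hK : IsK a R) {s : ℝ} (hs : s < Real.log R) :
    AnalyticAt ℝ (fulcrum a) s := by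
  refine ((analyticAt_shiftedMgf hK 0 hs).log (shiftedMgf_pos hK 0 hs)).congr ?_
  simpa using log_shiftedMgf_eventuallyEq hK 0 hs

lemma deriv_log_shiftedMgf (hK : IsK a R) (c : ℝ) {s : ℝ} (hs : s < Real.log R) :
    deriv (fun x => Real.log (shiftedMgf a c x)) s = deriv (fulcrum a) s - c := by
  rw [(log_shiftedMgf_eventuallyEq hK c hs).deriv_eq,
    deriv_fun_sub (analyticAt_fulcrum hK hs).differentiableAt (by fun_prop)]
  simp

lemma iteratedDeriv_log_shiftedMgf (hK : IsK a R) (c : ℝ) {s : ℝ} (hs : s < Real.log R) (i : ℕ) :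
    iteratedDeriv (i + 2) (fun x => Real.log (shiftedMgf a c x)) s =
      iteratedDeriv (i + 2) (fulcrum a) s := by
  have hev : deriv (fun x => Real.log (shiftedMgf a c x)) =ᶠ[𝓝 s]
      fun x => deriv (fulcrum a) x + -c := by
    filter_upwards [Iio_mem_nhds hs] with x hx
    rw [deriv_log_shiftedMgf hK c hx, sub_eq_add_neg]
  have hev' : deriv (deriv (fun x => Real.log (shiftedMgf a c x))) =ᶠ[𝓝 s]
      deriv (deriv (fulcrum a)) :=
    hev.deriv.trans (Eventually.of_forall fun x => by simp)
  rw [iteratedDeriv_succ', iteratedDeriv_succ', hev'.iteratedDeriv_eq,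
    iteratedDeriv_succ', iteratedDeriv_succ']

lemma deriv_fulcrum (hK : IsK a R) {s : ℝ} (hs : s < Real.log R) :
    deriv (fulcrum a) s = mf a (Real.exp s) := by
  have h := iteratedDeriv_succ_eq_sum_log (analyticAt_shiftedMgf hK 0 hs)
    (shiftedMgf_pos hK 0 hs) 0
  rw [iteratedDeriv_shiftedMgf hK 0 hs] at h
  simp only [zero_add, Finset.sum_range_one, iteratedDeriv_one, iteratedDeriv_zero, zero_mul,
    deriv_log_shiftedMgf hK 0 hs, neg_zero, Real.exp_zero, one_mul, sub_zero, Nat.sub_self,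
    Nat.choose_self, Nat.cast_one, pow_one, shiftedMgf_eq hK 0 s] at h
  rw [mf, eq_div_iff (fsum_pos hK hs).ne', ← h]
  exact tsum_congr fun n => by ring

lemma sigma2_eq (hK : IsK a R) {s : ℝ} (hs : s < Real.log R) :
    sigma2 a (Real.exp s) = iteratedDeriv 2 (fulcrum a) s := by
  have h := iteratedDeriv_succ_eq_sum_log (analyticAt_shiftedMgf hK 0 hs)
    (shiftedMgf_pos hK 0 hs) 1
  have h1 := iteratedDeriv_shiftedMgf hK 0 hs 1
  rw [iteratedDeriv_shiftedMgf hK 0 hs] at h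
  simp only [Finset.sum_range_succ, Finset.sum_range_zero, zero_add, Nat.choose_zero_right,
    Nat.choose_self, Nat.cast_one, one_mul, Nat.sub_zero, Nat.sub_self, h1, iteratedDeriv_zero,
    iteratedDeriv_one, deriv_log_shiftedMgf hK 0 hs, deriv_fulcrum hK hs,
    iteratedDeriv_log_shiftedMgf hK 0 hs 0, shiftedMgf_eq hK 0 s, neg_zero, zero_mul, Real.exp_zero,
    sub_zero, pow_one, Nat.reduceAdd] at h
  have hf := (fsum_pos hK hs).ne'
  have e1 : ∑' n : ℕ, a n * Real.exp s ^ n * (n : ℝ) =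
      mf a (Real.exp s) * fsum a (Real.exp s) := by
    rw [mf, div_mul_cancel₀ _ hf]
    exact tsum_congr fun n => by ring
  have e2 : ∑' n : ℕ, (n : ℝ) ^ 2 * a n * Real.exp s ^ n =
      ∑' n : ℕ, a n * Real.exp s ^ n * (n : ℝ) ^ 2 := tsum_congr fun n => by ring
  rw [sigma2, e2, h, e1]
  field_simp
  ring

lemma centralMoment_eq (a : ℕ → ℝ) (t : ℝ) (k : ℕ) :
    centralMoment a t k = (∑' n : ℕ, a n * t ^ n * ((n : ℝ) - mf a t) ^ k) / fsum a t := by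
  rw [centralMoment, ← tsum_div_const]
  exact tsum_congr fun n => by ring

lemma centralMoment_zero (hK : IsK a R) {s : ℝ} (hs : s < Real.log R) :
    centralMoment a (Real.exp s) 0 = 1 := by
  rw [centralMoment_eq]
  simp only [pow_zero, mul_one]
  exact div_self (fsum_pos hK hs).ne'

/-- The recursion expressing central moments through the derivatives of the fulcrum. -/
lemma centralMoment_succ (hK : IsK a R) {s : ℝ} (hs : s < Real.log R) (k : ℕ) :
    centralMoment a (Real.exp s) (k + 1) = ∑ i ∈ Finset.range k,
      (k.choose (i + 1) : ℝ) * iteratedDeriv (i + 2) (fulcrum a) s *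
        centralMoment a (Real.exp s) (k - (i + 1)) := by
  set m := mf a (Real.exp s) with hm
  have h := iteratedDeriv_succ_eq_sum_log (analyticAt_shiftedMgf hK m hs)
    (shiftedMgf_pos hK m hs) k
  rw [Finset.sum_range_succ'] at h
  simp only [zero_add, iteratedDeriv_one, deriv_log_shiftedMgf hK m hs, deriv_fulcrum hK hs, ← hm,
    sub_self, mul_zero, zero_mul, add_zero, add_assoc, Nat.reduceAdd,
    iteratedDeriv_log_shiftedMgf hK m hs, iteratedDeriv_shiftedMgf hK m hs] at h
  have he := (Real.exp_pos (-(m * s))).ne'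
  rw [centralMoment_eq, ← hm, ← mul_right_inj' he, ← mul_div_assoc, h, Finset.sum_div,
    Finset.mul_sum]
  refine Finset.sum_congr rfl fun i _ => ?_
  rw [centralMoment_eq, ← hm]
  ring

lemma sigma2_pos (hK : IsK a R) {s : ℝ} (hs : s < Real.log R) :
    0 < sigma2 a (Real.exp s) := by
  have h : centralMoment a (Real.exp s) 2 = sigma2 a (Real.exp s) := by
    have := centralMoment_succ hK hs 1
    simpa [centralMoment_zero hK hs, sigma2_eq hK hs] using this
  rw [← h, centralMoment_eq]
  refine div_pos ?_ (fsum_pos hK hs)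
  have hnn : ∀ n : ℕ, 0 ≤ a n * Real.exp s ^ n * ((n : ℝ) - mf a (Real.exp s)) ^ 2 := fun n =>
    mul_nonneg (mul_nonneg (hK.nonneg n) (pow_nonneg (Real.exp_pos s).le n)) (sq_nonneg _)
  have hpos : ∀ n : ℕ, 0 < a n → (n : ℝ) ≠ mf a (Real.exp s) →
      0 < a n * Real.exp s ^ n * ((n : ℝ) - mf a (Real.exp s)) ^ 2 := fun n hn hne =>
    mul_pos (mul_pos hn (pow_pos (Real.exp_pos s) n)) (sq_pos_of_ne_zero (sub_ne_zero.2 hne))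
  obtain ⟨N, hN, haN⟩ := hK.nonconst
  have hsum := summable_mul_sub_pow hK (mf a (Real.exp s)) hs 2
  by_cases h0 : ((0 : ℕ) : ℝ) = mf a (Real.exp s)
  · refine hsum.tsum_pos hnn N (hpos N haN fun hN' => hN.ne' ?_)
    exact_mod_cast hN'.trans h0.symm
  · exact hsum.tsum_pos hnn 0 (hpos 0 hK.pos₀ h0)

lemma normMoment_eq (a : ℕ → ℝ) (t : ℝ) (k : ℕ) :
    normMoment a t k = centralMoment a t k / sigma a t ^ k := by
  rw [normMoment, centralMoment, ← tsum_div_const]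
  exact tsum_congr fun n => by rw [div_pow]; ring

lemma Fq_eq (hK : IsK a R) {s : ℝ} (hs : s < Real.log R) (j : ℕ) :
    Fq a j s = iteratedDeriv j (fulcrum a) s / sigma a (Real.exp s) ^ j := by
  rw [Fq, ← sigma2_eq hK hs, sigma, Real.sqrt_eq_rpow, ← Real.rpow_natCast,
    ← Real.rpow_mul (sigma2_pos hK hs).le]
  ring_nf

lemma Fq_two (hK : IsK a R) {s : ℝ} (hs : s < Real.log R) : Fq a 2 s = 1 := by
  rw [Fq_eq hK hs, ← sigma2_eq hK hs, sigma, Real.sq_sqrt (sigma2_pos hK hs).le]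
  exact div_self (sigma2_pos hK hs).ne'

lemma normMoment_succ (hK : IsK a R) {s : ℝ} (hs : s < Real.log R) (k : ℕ) :
    normMoment a (Real.exp s) (k + 1) = ∑ i ∈ Finset.range k,
      (k.choose (i + 1) : ℝ) * Fq a (i + 2) s * normMoment a (Real.exp s) (k - (i + 1)) := by
  rw [normMoment_eq, centralMoment_succ hK hs, Finset.sum_div]
  refine Finset.sum_congr rfl fun i hi => ?_
  have hi : i < k := Finset.mem_range.1 hi
  have e : k + 1 = (i + 2) + (k - (i + 1)) := by omega
  rw [normMoment_eq, Fq_eq hK hs, show sigma a (Real.exp s) ^ (k + 1) =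
    sigma a (Real.exp s) ^ (i + 2) * sigma a (Real.exp s) ^ (k - (i + 1)) by rw [← pow_add, ← e]]
  ring

lemma gaussMoment_add_two (k : ℕ) : gaussMoment (k + 2) = (k + 1) * gaussMoment k := by
  unfold gaussMoment
  by_cases h : Even k
  · have h2 : Even (k + 2) := by simpa [Nat.even_add] using h
    obtain ⟨r, rfl⟩ := h
    rw [if_pos h2, if_pos ⟨r, rfl⟩, show (r + r + 2) / 2 = r + 1 by omega,
      show (r + r) / 2 = r by omega, Nat.factorial_succ, Nat.factorial_succ, Nat.factorial_succ]
    have : (r.factorial : ℝ) ≠ 0 := by positivity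
    push_cast
    field_simp
    ring
  · have h2 : ¬ Even (k + 2) := by simpa [Nat.even_add] using h
    rw [if_neg h2, if_neg h, mul_zero]

section Recursion

variable {α : Type*} {l : Filter α} {M Q : ℕ → α → ℝ}

/-- If moments and normalized cumulants of order below `p + 3` have Gaussian limits, then the
difference of the moment and the normalized cumulant of order `p + 3` tends to the Gaussian
moment. -/
lemma tendsto_moment_sub_cumulant
    (hrec : ∀ᶠ x in l, ∀ k, M (k + 1) x = ∑ i ∈ Finset.range k,
      (k.choose (i + 1) : ℝ) * Q (i + 2) x * M (k - (i + 1)) x)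
    (hM0 : ∀ᶠ x in l, M 0 x = 1) (hQ2 : ∀ᶠ x in l, Q 2 x = 1) (p : ℕ)
    (hM : ∀ j < p + 3, Tendsto (M j) l (𝓝 (gaussMoment j)))
    (hQ : ∀ j, 3 ≤ j → j < p + 3 → Tendsto (Q j) l (𝓝 0)) :
    Tendsto (fun x => M (p + 3) x - Q (p + 3) x) l (𝓝 (gaussMoment (p + 3))) := by
  have hlim : Tendsto (fun x => (∑ i ∈ Finset.range p,
      ((p + 2).choose (i + 2) : ℝ) * Q (i + 3) x * M (p - i) x) + ((p + 1 : ℕ) + 1) * M (p + 1) x)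
      l (𝓝 ((∑ i ∈ Finset.range p, ((p + 2).choose (i + 2) : ℝ) * 0 * gaussMoment (p - i)) +
        ((p + 1 : ℕ) + 1) * gaussMoment (p + 1))) := by
    refine Tendsto.add (tendsto_finsetSum _ fun i hi => ?_) ((hM _ (by omega)).const_mul _)
    have hi : i < p := Finset.mem_range.1 hi
    exact ((hQ _ (by omega) (by omega)).const_mul _).mul (hM _ (by omega))
  rw [← gaussMoment_add_two] at hlim
  simp only [mul_zero, zero_mul, Finset.sum_const_zero, zero_add] at hlim
  refine hlim.congr' ?_
  filter_upwards [hrec, hM0, hQ2] with x hx h0 h2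
  rw [hx (p + 2), Finset.sum_range_succ, Finset.sum_range_succ']
  simp only [show p + 1 + 1 = p + 2 by rfl, show p + 1 + 2 = p + 3 by rfl, Nat.sub_self, h0,
    Nat.choose_self, zero_add, h2, Nat.choose_one_right, show p + 2 - 1 = p + 1 by rfl, add_assoc,
    Nat.reduceAdd, Nat.reduceSubDiff]
  push_cast
  ring

lemma tendsto_moments_iff_tendsto_cumulants
    (hrec : ∀ᶠ x in l, ∀ k, M (k + 1) x = ∑ i ∈ Finset.range k,
      (k.choose (i + 1) : ℝ) * Q (i + 2) x * M (k - (i + 1)) x)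
    (hM0 : ∀ᶠ x in l, M 0 x = 1) (hQ2 : ∀ᶠ x in l, Q 2 x = 1) (n : ℕ) :
    (∀ j, 3 ≤ j → j ≤ n → Tendsto (M j) l (𝓝 (gaussMoment j))) ↔
      ∀ j, 3 ≤ j → j ≤ n → Tendsto (Q j) l (𝓝 0) := by
  have hsmall : ∀ j < 3, Tendsto (M j) l (𝓝 (gaussMoment j)) := by
    intro j hj
    refine tendsto_const_nhds.congr' ?_
    filter_upwards [hrec, hM0, hQ2] with x hx h0 h2
    interval_cases j
    · simp [h0, gaussMoment]
    · simp [hx 0, gaussMoment]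
    · simp [hx 1, h0, h2, gaussMoment]
  constructor
  · intro h j
    induction j using Nat.strong_induction_on with
    | _ j ih =>
      intro h3 hjn
      obtain ⟨p, rfl⟩ := Nat.exists_eq_add_of_le' h3
      have hd := tendsto_moment_sub_cumulant hrec hM0 hQ2 p
        (fun j hj => (lt_or_ge j 3).elim (hsmall j) fun h3 => h j h3 (by omega))
        (fun j h3 hj => ih j hj h3 (by omega))
      simpa using (h _ h3 hjn).sub hd
  · intro h j
    induction j using Nat.strong_induction_on with
    | _ j ih =>
      intro h3 hjn
      obtain ⟨p, rfl⟩ := Nat.exists_eq_add_of_le' h3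
      have hd := tendsto_moment_sub_cumulant hrec hM0 hQ2 p
        (fun j hj => (lt_or_ge j 3).elim (hsmall j) fun h3 => ih j hj h3 (by omega))
        (fun j h3 hj => h j h3 (by omega))
      simpa using hd.add (h _ h3 hjn)

end Recursion

lemma map_exp_nhdsLT_log (hR : 0 < R) : map Real.exp (𝓝[<] Real.log R) = 𝓝[<] R := by
  have h := Real.isOpenEmbedding_exp.map_nhdsWithin_preimage_eq (Set.Iio R) (Real.log R)
  rwa [Real.exp_log hR, show Real.exp ⁻¹' Set.Iio R = Set.Iio (Real.log R) by
    ext x; exact (Real.lt_log_iff_exp_lt hR).symm] at h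

end

/-- the moments `E(X̆_t^j)` converge to the normal moments for `3 ≤ j ≤ n`
iff the quotients `F^{(j)}(s)/F''(s)^{j/2}` tend to `0` for `3 ≤ j ≤ n`. -/
theorem statement5 (a : ℕ → ℝ) (R : ℝ) (hK : IsK a R) (n : ℕ) (hn : 3 ≤ n) :
    (∀ j : ℕ, 3 ≤ j → j ≤ n →
        Tendsto (fun t => normMoment a t j) (𝓝[<] R) (𝓝 (gaussMoment j))) ↔
    (∀ j : ℕ, 3 ≤ j → j ≤ n →
        Tendsto (fun s => Fq a j s) (𝓝[<] Real.log R) (𝓝 0)) := by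
  have hlt : ∀ᶠ s in 𝓝[<] Real.log R, s < Real.log R := self_mem_nhdsWithin
  rw [← map_exp_nhdsLT_log hK.Rpos]
  simp only [tendsto_map'_iff]
  exact tendsto_moments_iff_tendsto_cumulants
    (M := fun j s => normMoment a (Real.exp s) j) (Q := Fq a)
    (hlt.mono fun s hs => normMoment_succ hK hs)
    (hlt.mono fun s hs => by simp [normMoment_eq, centralMoment_zero hK hs])
    (hlt.mono fun s hs => Fq_two hK hs) n

end KhinchinPaper
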